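/- arXiv:2312.07060 — 4 statements merged into one kernel-verified Lean document; each statement's English description precedes it below -/
import Mathlib

section
/- Let K, Q, B, d, N be positive integers, let η, α, S₂, ε be positive reals, δ ∈ (0,1), τ ≥ 1 a real, and F* a real number. Set C_Q = (2Q−1)(Q−1)/(6Q) + 1 and, for each 0 ≤ k < K, set σ_k² = (4S₂²B·ln(1/δ)/(N²ε²)) · (Σ_{i=0}^{K-1} τ^{-i/2}) · τ^{k/2}. Let (a_k)_{k=0..K} and (g_k)_{k=0..K-1} be real sequences with g_k ≥ 0, a_K ≥ F*, and suppose that for every 0 ≤ k < K both a_{k+1} − a_k ≤ −(ηQ/2)·g_k + (ηQ²α²/(2B))·C_Q + d·σ_k²/(2Bη) and −(ηQ/2)·g_k + (ηQ²α²/(2B))·C_Q + d·σ_k²/(2Bη) ≤ 0 hold. Then, with AM_K = (1/K)Σ_{k=0}^{K-1} τ^{-k/2} and QM_K² = (1/K)Σ_{k=0}^{K-1} τ^{-k}, one has (Σ_{k=0}^{K-1} τ^{-k} g_k)/(Σ_{k=0}^{K-1} τ^{-k}) ≤ 2(a_0 − F*)/(Qη·Σ_{k=0}^{K-1} τ^{-k})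 + (Qα²/B)·C_Q + (4dS₂²K·ln(1/δ)/(η²Q N²ε²)) · (AM_K²/QM_K²). -/
open Finset

/-- Theorem 2 of the paper: convergence of Gau-LRQ-SGD with dynamic privacy
budget allocation, stated conditionally on the per-round descent inequality.
Here real exponents `τ ^ (-(k : ℝ))` etc. denote `Real.rpow`. -/
theorem gau_lrq_sgd_convergence_dynamic
    (K Q B d N : ℕ) (hK : 0 < K) (hQ : 0 < Q) (hB : 0 < B) (hd : 0 < d) (hN : 0 < N)
    (η α S₂ ε δ τ Fstar : ℝ)
    (hη : 0 < η) (hα : 0 < α) (hS₂ : 0 < S₂) (hε : 0 < ε)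
    (hδ : δ ∈ Set.Ioo (0 : ℝ) 1) (hτ : 1 ≤ τ)
    (CQ : ℝ)
    (hCQ : CQ = (2 * (Q : ℝ) - 1) * ((Q : ℝ) - 1) / (6 * Q) + 1)
    (σsq : ℕ → ℝ)
    (hσsq : ∀ k < K,
      σsq k = (4 * S₂ ^ 2 * B * Real.log (1 / δ) / ((N : ℝ) ^ 2 * ε ^ 2)) *
        (∑ i ∈ range K, τ ^ (-(i : ℝ) / 2)) * τ ^ ((k : ℝ) / 2))
    (a g : ℕ → ℝ)
    (hg : ∀ k < K, 0 ≤ g k)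
    (haK : a K ≥ Fstar)
    (hstep : ∀ k < K,
      a (k + 1) - a k ≤
        -(η * Q / 2) * g k + (η * (Q : ℝ) ^ 2 * α ^ 2 / (2 * B)) * CQ +
          d * σsq k / (2 * B * η))
    (hneg : ∀ k < K,
      -(η * Q / 2) * g k + (η * (Q : ℝ) ^ 2 * α ^ 2 / (2 * B)) * CQ +
          d * σsq k / (2 * B * η) ≤ 0)
    (AM QMsq : ℝ)
    (hAM : AM = (1 / (K : ℝ)) * ∑ k ∈ range K, τ ^ (-(k : ℝ) / 2))
    (hQM : QMsq = (1 / (K : ℝ)) * ∑ k ∈ range K, τ ^ (-(k : ℝ))) :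
    (∑ k ∈ range K, τ ^ (-(k : ℝ)) * g k) / (∑ k ∈ range K, τ ^ (-(k : ℝ))) ≤
      2 * (a 0 - Fstar) / (Q * η * ∑ k ∈ range K, τ ^ (-(k : ℝ))) +
        ((Q : ℝ) * α ^ 2 / B) * CQ +
        (4 * d * S₂ ^ 2 * K * Real.log (1 / δ) / (η ^ 2 * Q * (N : ℝ) ^ 2 * ε ^ 2)) *
          (AM ^ 2 / QMsq) := by
  have hτ0 : 0 < τ := by linarith
  have hK' : (0 : ℝ) < K := by exact_mod_cast hK
  have hQ' : (0 : ℝ) < Q := by exact_mod_cast hQ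
  have hB' : (0 : ℝ) < B := by exact_mod_cast hB
  have hN' : (0 : ℝ) < N := by exact_mod_cast hN
  have hW : 0 < ∑ k ∈ range K, τ ^ (-(k : ℝ)) := by
    apply Finset.sum_pos
    · intro i _
      exact Real.rpow_pos_of_pos hτ0 _
    · exact ⟨0, by simpa using hK⟩
  -- telescoping
  have htel : Fstar - a 0 ≤ ∑ k ∈ range K, τ ^ (-(k : ℝ)) *
      (-(η * Q / 2) * g k + (η * (Q : ℝ) ^ 2 * α ^ 2 / (2 * B)) * CQ +
          d * σsq k / (2 * B * η)) := by
    have h1 : ∑ k ∈ range K, (a (k + 1) - a k) = a K - a 0 := Finset.sum_range_sub a K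
    have h2 : ∑ k ∈ range K, (a (k + 1) - a k) ≤ ∑ k ∈ range K, τ ^ (-(k : ℝ)) *
      (-(η * Q / 2) * g k + (η * (Q : ℝ) ^ 2 * α ^ 2 / (2 * B)) * CQ +
          d * σsq k / (2 * B * η)) := by
      apply Finset.sum_le_sum
      intro k hk
      have hk' := Finset.mem_range.mp hk
      have hw : τ ^ (-(k : ℝ)) ≤ 1 :=
        Real.rpow_le_one_of_one_le_of_nonpos hτ (by simp)
      have h3 := hstep k hk'
      have h4 := hneg k hk'
      nlinarith [mul_nonneg (sub_nonneg.mpr hw) (neg_nonneg.mpr h4)]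
    linarith
  have hsum : ∑ k ∈ range K, τ ^ (-(k : ℝ)) *
      (-(η * Q / 2) * g k + (η * (Q : ℝ) ^ 2 * α ^ 2 / (2 * B)) * CQ +
          d * σsq k / (2 * B * η)) =
      -(η * Q / 2) * (∑ k ∈ range K, τ ^ (-(k : ℝ)) * g k) +
      (η * (Q : ℝ) ^ 2 * α ^ 2 / (2 * B)) * CQ * (∑ k ∈ range K, τ ^ (-(k : ℝ))) +
      d * ((4 * S₂ ^ 2 * B * Real.log (1 / δ) / ((N : ℝ) ^ 2 * ε ^ 2)) *
        (∑ i ∈ range K, τ ^ (-(i : ℝ) / 2))) / (2 * B * η) *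
        (∑ i ∈ range K, τ ^ (-(i : ℝ) / 2)) := by
    rw [Finset.mul_sum (range K) (fun k : ℕ => τ ^ (-(k : ℝ)) * g k),
      Finset.mul_sum (range K) (fun k : ℕ => τ ^ (-(k : ℝ))),
      Finset.mul_sum (range K) (fun k : ℕ => τ ^ (-(k : ℝ) / 2)) (d * _ / _),
      ← Finset.sum_add_distrib, ← Finset.sum_add_distrib]
    apply Finset.sum_congr rfl
    intro k hk
    rw [hσsq k (Finset.mem_range.mp hk)]
    have hp : τ ^ (-(k : ℝ) / 2) = τ ^ (-(k : ℝ)) * τ ^ ((k : ℝ) / 2) := by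
      rw [← Real.rpow_add hτ0]
      congr 1
      ring
    rw [hp]
    ring
  rw [hsum] at htel
  rw [hAM, hQM]
  clear hsum hstep hneg hσsq
  generalize (∑ k ∈ range K, τ ^ (-(k : ℝ)) * g k) = G at *
  generalize (∑ k ∈ range K, τ ^ (-(k : ℝ))) = W at *
  generalize (∑ k ∈ range K, τ ^ (-(k : ℝ) / 2)) = A at *
  generalize Real.log (1 / δ) = L at *
  rw [div_le_iff₀ hW]
  have hc : 0 < η * Q / 2 := by positivity
  refine le_of_mul_le_mul_left ?_ hc
  have e : η * Q / 2 * ((2 * (a 0 - Fstar) / (Q * η * W) +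
        ((Q : ℝ) * α ^ 2 / B) * CQ +
        (4 * d * S₂ ^ 2 * K * L / (η ^ 2 * Q * (N : ℝ) ^ 2 * ε ^ 2)) *
          ((1 / (K : ℝ) * A) ^ 2 / (1 / (K : ℝ) * W))) * W) =
      (a 0 - Fstar) + (η * (Q : ℝ) ^ 2 * α ^ 2 / (2 * B)) * CQ * W +
      d * ((4 * S₂ ^ 2 * B * L / ((N : ℝ) ^ 2 * ε ^ 2)) * A) / (2 * B * η) * A := by
    field_simp
  rw [e]
  linarith
end

section
/- Let d, Q, B be positive integers and η, ν, α, σ real numbers with η > 0, ν > 0, α ≥ 0, σ ≥ 0, and suppose ν²η²Q(Q−1)/2 + νηQ ≤ 1 and νη ≤ 1. Let g, m_1, …, m_{Q−1} ∈ ℝ^d, let F₀, Φ, s be real numbers with s ≥ 0, and set μ = −η(g + Σ_{q=1}^{Q-1} m_q) and C_Q = (2Q−1)(Q−1)/(6Q) + 1. Assume: (i) Φ ≤ F₀ + ⟨g, μ⟩ + (ν/2)·s; (ii) s ≤ Q²η²α²/B + Qη²‖g‖² + Qη²·Σ_{q=1}^{Q-1}‖m_q‖² + dσ²/B; (iii)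 Σ_{q=1}^{Q-1} ‖g − m_q‖² ≤ ν²η²·[ α²Q(2Q−1)(Q−1)/(6B) + (Q(Q−1)/2)·(‖g‖² + Σ_{q=1}^{Q-1}‖m_q‖²) ]. Then Φ − F₀ ≤ −(ηQ/2)·‖g‖² + (ηQ²α²/(2B))·C_Q + dσ²/(2Bη). -/
open Finset
open scoped RealInnerProductSpace

/-- The main per-round computation in the proof of Theorem 1, stated
abstractly: combining the smooth-descent bound (i), the second-moment bound
on the aggregated update (ii), and the client-drift bound (iii) yields the
per-round decrease of the loss. -/
theorem per_round_descent
    (d Q B : ℕ) (hd : 0 < d) (hQ : 0 < Q) (hB : 0 < B)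
    (η ν α σ : ℝ) (hη : 0 < η) (hν : 0 < ν) (hα : 0 ≤ α) (hσ : 0 ≤ σ)
    (hlr₁ : ν ^ 2 * η ^ 2 * Q * ((Q : ℝ) - 1) / 2 + ν * η * Q ≤ 1)
    (hlr₂ : ν * η ≤ 1)
    (g : EuclideanSpace ℝ (Fin d)) (m : ℕ → EuclideanSpace ℝ (Fin d))
    (F₀ Φ s : ℝ) (hs : 0 ≤ s)
    (μ : EuclideanSpace ℝ (Fin d))
    (hμ : μ = -η • (g + ∑ q ∈ Ico 1 Q, m q))
    (CQ : ℝ)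
    (hCQ : CQ = (2 * (Q : ℝ) - 1) * ((Q : ℝ) - 1) / (6 * Q) + 1)
    (h₁ : Φ ≤ F₀ + ⟪g, μ⟫ + (ν / 2) * s)
    (h₂ : s ≤ (Q : ℝ) ^ 2 * η ^ 2 * α ^ 2 / B + Q * η ^ 2 * ‖g‖ ^ 2 +
      Q * η ^ 2 * ∑ q ∈ Ico 1 Q, ‖m q‖ ^ 2 + d * σ ^ 2 / B)
    (h₃ : ∑ q ∈ Ico 1 Q, ‖g - m q‖ ^ 2 ≤
      ν ^ 2 * η ^ 2 *
        (α ^ 2 * Q * (2 * (Q : ℝ) - 1) * ((Q : ℝ) - 1) / (6 * B) +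
          ((Q : ℝ) * ((Q : ℝ) - 1) / 2) *
            (‖g‖ ^ 2 + ∑ q ∈ Ico 1 Q, ‖m q‖ ^ 2))) :
    Φ - F₀ ≤ -(η * Q / 2) * ‖g‖ ^ 2 + (η * (Q : ℝ) ^ 2 * α ^ 2 / (2 * B)) * CQ +
      d * σ ^ 2 / (2 * B * η) := by
  have hQ1 : (1 : ℝ) ≤ Q := by exact_mod_cast hQ
  have hB0 : (0 : ℝ) < B := by exact_mod_cast hB
  have hsum : ∑ q ∈ Ico 1 Q, ‖g - m q‖ ^ 2 =
      ((Q : ℝ) - 1) * ‖g‖ ^ 2 - 2 * ⟪g, ∑ q ∈ Ico 1 Q, m q⟫ + ∑ q ∈ Ico 1 Q, ‖m q‖ ^ 2 := by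
    simp only [norm_sub_sq_real, sum_add_distrib, sum_sub_distrib, inner_sum, mul_sum]
    simp [Nat.cast_sub (show 1 ≤ Q from hQ)]
  have hin : ⟪g, μ⟫ = -η * (‖g‖ ^ 2 + ⟪g, ∑ q ∈ Ico 1 Q, m q⟫) := by
    rw [hμ, inner_smul_right, inner_add_right, real_inner_self_eq_norm_sq]
  have hM : 0 ≤ ∑ q ∈ Ico 1 Q, ‖m q‖ ^ 2 := sum_nonneg fun _ _ => by positivity
  have hG : 0 ≤ ‖g‖ ^ 2 := by positivity
  rw [hin] at h₁
  rw [hsum] at h₃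
  generalize ∑ q ∈ Ico 1 Q, ‖m q‖ ^ 2 = M at *
  generalize ⟪g, ∑ q ∈ Ico 1 Q, m q⟫ = I at *
  generalize ‖g‖ ^ 2 = G at *
  have hA : 0 ≤ α ^ 2 * Q * (2 * (Q : ℝ) - 1) * ((Q : ℝ) - 1) / (6 * B) := by
    have h1 : (0 : ℝ) ≤ 2 * (Q : ℝ) - 1 := by linarith
    have h2 : (0 : ℝ) ≤ (Q : ℝ) - 1 := by linarith
    positivity
  have hX : 0 ≤ (Q : ℝ) ^ 2 * α ^ 2 / B := by positivity
  have hY : 0 ≤ d * σ ^ 2 / (2 * B * η) := by positivity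
  have eY : ν / 2 * (d * σ ^ 2 / B) = (ν * η) * (d * σ ^ 2 / (2 * B * η)) := by
    field_simp
  have eX : (Q : ℝ) ^ 2 * η ^ 2 * α ^ 2 / B = η ^ 2 * ((Q : ℝ) ^ 2 * α ^ 2 / B) := by ring
  have eC : (η * (Q : ℝ) ^ 2 * α ^ 2 / (2 * B)) * CQ =
      η / 2 * (α ^ 2 * Q * (2 * (Q : ℝ) - 1) * ((Q : ℝ) - 1) / (6 * B)
        + (Q : ℝ) ^ 2 * α ^ 2 / B) := by
    rw [hCQ]; field_simp
  rw [eC]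
  rw [eX] at h₂
  generalize α ^ 2 * Q * (2 * (Q : ℝ) - 1) * ((Q : ℝ) - 1) / (6 * B) = A at *
  generalize (Q : ℝ) ^ 2 * α ^ 2 / B = X at *
  generalize d * σ ^ 2 / (2 * B * η) = Y at *
  generalize d * σ ^ 2 / B = Z at *
  have t1 := mul_le_mul_of_nonneg_left h₂ (half_pos hν).le
  have t2 := mul_le_mul_of_nonneg_left h₃ (half_pos hη).le
  have t3 := mul_le_mul_of_nonneg_right hlr₂ hY
  have t4 := mul_le_mul_of_nonneg_right hlr₂ (mul_nonneg (half_pos hη).le hX)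
  have hsq : (ν * η) ^ 2 ≤ 1 := pow_le_one₀ (by positivity) hlr₂
  have t5 := mul_le_mul_of_nonneg_right hsq (mul_nonneg (half_pos hη).le hA)
  have t6 := mul_le_mul_of_nonneg_right hlr₁ (mul_nonneg (half_pos hη).le (add_nonneg hG hM))
  linarith
end

section
/- Let K ≥ 1 be an integer, τ ≥ 1 and C > 0 reals. For 0 ≤ k < K define s*_k = C·(Σ_{i=0}^{K-1} τ^{-i/2})·τ^{k/2}. Then: (i) Σ_{k=0}^{K-1} 1/s*_k = 1/C; (ii) Σ_{k=0}^{K-1} τ^{-k}·s*_k = C·(Σ_{k=0}^{K-1} τ^{-k/2})²; and (iii) for every choice of positive reals s_0, …, s_{K−1} with Σ_{k=0}^{K-1} 1/s_k ≤ 1/C, one has Σ_{k=0}^{K-1} τ^{-k}·s_k ≥ C·(Σ_{k=0}^{K-1} τ^{-k/2})². In particular, s* minimizes the weighted sum Σ_{k=0}^{K-1} τ^{-k}·s_k over all allocations satisfying the constraint Σ_{k=0}^{K-1} 1/s_k ≤ 1/C. -/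
open Finset

/-- The dynamic privacy-budget allocation result: the allocation
`s*_k = C·(Σ_i τ^{-i/2})·τ^{k/2}` meets the privacy constraint with equality
and minimizes the `τ`-weighted noise `Σ_k τ^{-k}·s_k` among all allocations
with `Σ_k 1/s_k ≤ 1/C`.  Real exponents denote `Real.rpow`. -/
theorem optimal_privacy_budget_allocation
    (K : ℕ) (hK : 1 ≤ K) (τ C : ℝ) (hτ : 1 ≤ τ) (hC : 0 < C)
    (sstar : ℕ → ℝ)
    (hsstar : ∀ k < K,
      sstar k = C * (∑ i ∈ range K, τ ^ (-(i : ℝ) / 2)) * τ ^ ((k : ℝ) / 2)) :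
    (∑ k ∈ range K, 1 / sstar k) = 1 / C ∧
    (∑ k ∈ range K, τ ^ (-(k : ℝ)) * sstar k) =
      C * (∑ k ∈ range K, τ ^ (-(k : ℝ) / 2)) ^ 2 ∧
    ∀ s : ℕ → ℝ, (∀ k < K, 0 < s k) → (∑ k ∈ range K, 1 / s k) ≤ 1 / C →
      C * (∑ k ∈ range K, τ ^ (-(k : ℝ) / 2)) ^ 2 ≤
        ∑ k ∈ range K, τ ^ (-(k : ℝ)) * s k := by
  have hτ0 : 0 < τ := by linarith
  have hApos : 0 < ∑ i ∈ range K, τ ^ (-(i : ℝ) / 2) :=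
    Finset.sum_pos (fun i _ => Real.rpow_pos_of_pos hτ0 _)
      (Finset.nonempty_range_iff.mpr (by omega))
  refine ⟨?_, ?_, ?_⟩
  · have h1 : ∀ k ∈ range K, 1 / sstar k =
        τ ^ (-(k : ℝ) / 2) * (1 / (C * ∑ i ∈ range K, τ ^ (-(i : ℝ) / 2))) := by
      intro k hk
      rw [hsstar k (Finset.mem_range.mp hk), neg_div, Real.rpow_neg hτ0.le]
      simp only [one_div, mul_inv]
      ring
    rw [Finset.sum_congr rfl h1, ← Finset.sum_mul]
    generalize (∑ i ∈ range K, τ ^ (-(i : ℝ) / 2)) = A at hApos ⊢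
    field_simp
  · have h2 : ∀ k ∈ range K, τ ^ (-(k : ℝ)) * sstar k =
        (C * ∑ i ∈ range K, τ ^ (-(i : ℝ) / 2)) * τ ^ (-(k : ℝ) / 2) := by
      intro k hk
      have h3 : τ ^ (-(k : ℝ) / 2) = τ ^ (-(k : ℝ)) * τ ^ ((k : ℝ) / 2) := by
        rw [← Real.rpow_add hτ0]
        congr 1
        ring
      rw [hsstar k (Finset.mem_range.mp hk), h3]
      ring
    rw [Finset.sum_congr rfl h2, ← Finset.mul_sum]
    ring
  · intro s hs hsum
    have hcs : (∑ k ∈ range K, τ ^ (-(k : ℝ) / 2)) ^ 2 ≤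
        (∑ k ∈ range K, τ ^ (-(k : ℝ)) * s k) * ∑ k ∈ range K, 1 / s k := by
      apply Finset.sum_sq_le_sum_mul_sum_of_sq_eq_mul
      · intro k hk
        exact mul_nonneg (Real.rpow_nonneg hτ0.le _) (hs k (Finset.mem_range.mp hk)).le
      · intro k hk
        exact (one_div_pos.mpr (hs k (Finset.mem_range.mp hk))).le
      · intro k hk
        have hk0 := (hs k (Finset.mem_range.mp hk)).ne'
        have h4 : (τ ^ (-(k : ℝ) / 2)) ^ 2 = τ ^ (-(k : ℝ)) := by
          rw [sq, ← Real.rpow_add hτ0]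
          congr 1
          ring
        rw [h4, mul_assoc, mul_one_div_cancel hk0, mul_one]
    have hnn : 0 ≤ ∑ k ∈ range K, τ ^ (-(k : ℝ)) * s k :=
      Finset.sum_nonneg fun k hk =>
        mul_nonneg (Real.rpow_nonneg hτ0.le _) (hs k (Finset.mem_range.mp hk)).le
    have h5 := hcs.trans (mul_le_mul_of_nonneg_left hsum hnn)
    rw [mul_one_div, le_div_iff₀ hC] at h5
    linarith
end

section
/- Let ε ∈ (0,1), δ ∈ (0,1), s > 0 and σ > 0 with σ ≥ s·√(2·ln(1.25/δ))/ε. Then for all real numbers c, c' with |c − c'| ≤ s and every Borel measurable set A ⊆ ℝ, the Gaussian measures satisfy N(c, σ²)(A) ≤ e^ε · N(c', σ²)(A) + δ, where N(m, σ²) denotes the Gaussian probability measure on ℝ with mean m and variance σ². -/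
open MeasureTheory ProbabilityTheory

lemma gm_half : gaussianReal 0 1 (Set.Ioi 0) ≤ ENNReal.ofReal (1 / 2) := by
  have h1 : gaussianReal 0 1 (Set.Iio 0) = gaussianReal 0 1 (Set.Ioi 0) := by
    have h := gaussianReal_map_neg (μ := 0) (v := 1)
    rw [neg_zero] at h
    conv_rhs => rw [← h]
    rw [Measure.map_apply measurable_neg measurableSet_Ioi]
    congr 1
    ext x; simp
  have h2 : gaussianReal 0 1 (Set.Iio 0) + gaussianReal 0 1 (Set.Ioi 0) ≤ 1 := by
    rw [← measure_union _ measurableSet_Ioi]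
    · exact prob_le_one
    · rw [Set.disjoint_left]; intro x hx hx'
      exact lt_asymm (Set.mem_Iio.1 hx) (Set.mem_Ioi.1 hx')
  rw [h1] at h2
  have h3 : gaussianReal 0 1 (Set.Ioi 0) ≠ ⊤ := measure_ne_top _ _
  rw [ENNReal.le_ofReal_iff_toReal_le h3 (by norm_num)]
  have h4 := ENNReal.toReal_mono ENNReal.one_ne_top h2
  rw [ENNReal.toReal_add h3 h3, ENNReal.toReal_one] at h4
  linarith

lemma gm_tail (t : ℝ) (ht : 0 ≤ t) :
    gaussianReal 0 1 (Set.Ioi t) ≤ ENNReal.ofReal (1 / 2 * Real.exp (-t ^ 2 / 2)) := by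
  have h1 : gaussianReal 0 1 (Set.Ioi t) = gaussianReal (-t) 1 (Set.Ioi 0) := by
    have h := gaussianReal_map_sub_const (μ := 0) (v := 1) t
    rw [zero_sub] at h
    rw [← h, Measure.map_apply (by fun_prop) measurableSet_Ioi]
    congr 1
    ext x; simp
  rw [h1, gaussianReal_apply _ one_ne_zero]
  calc ∫⁻ x in Set.Ioi 0, gaussianPDF (-t) 1 x
      ≤ ∫⁻ x in Set.Ioi 0, ENNReal.ofReal (Real.exp (-t ^ 2 / 2)) * gaussianPDF 0 1 x := by
        apply setLIntegral_mono' measurableSet_Ioi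
        intro x hx
        have hx : 0 < x := hx
        rw [gaussianPDF, gaussianPDF, ← ENNReal.ofReal_mul (Real.exp_nonneg _)]
        apply ENNReal.ofReal_le_ofReal
        simp only [gaussianPDFReal, NNReal.coe_one]
        rw [mul_left_comm, ← Real.exp_add]
        apply mul_le_mul_of_nonneg_left _ (by positivity)
        apply Real.exp_le_exp.2
        nlinarith [mul_nonneg ht hx.le]
    _ = ENNReal.ofReal (Real.exp (-t ^ 2 / 2)) * gaussianReal 0 1 (Set.Ioi 0) := by
        rw [lintegral_const_mul _ (measurable_gaussianPDF _ _), gaussianReal_apply _ one_ne_zero]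
    _ ≤ ENNReal.ofReal (Real.exp (-t ^ 2 / 2)) * ENNReal.ofReal (1 / 2) := by
        gcongr; exact gm_half
    _ = _ := by
        rw [← ENNReal.ofReal_mul (Real.exp_nonneg _), mul_comm]

lemma gm_mid (t : ℝ) (ht : t ≤ 0) :
    gaussianReal 0 1 (Set.Ioi t) ≤ ENNReal.ofReal (-t + 1 / 2) := by
  rw [← Set.Ioc_union_Ioi_eq_Ioi ht, ENNReal.ofReal_add (by linarith) (by norm_num)]
  refine (measure_union_le _ _).trans (add_le_add ?_ gm_half)
  rw [gaussianReal_apply _ one_ne_zero]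
  calc ∫⁻ x in Set.Ioc t 0, gaussianPDF 0 1 x ≤ ∫⁻ x in Set.Ioc t 0, 1 := by
        apply lintegral_mono
        intro x
        rw [gaussianPDF]
        apply ENNReal.ofReal_le_one.2
        simp only [gaussianPDFReal, NNReal.coe_one]
        have h1 : (√(2 * Real.pi * 1))⁻¹ ≤ 1 := by
          apply inv_le_one_of_one_le₀
          rw [Real.one_le_sqrt]
          linarith [Real.pi_gt_three]
        have h2 : Real.exp (-(x - 0) ^ 2 / (2 * 1)) ≤ 1 := by
          apply Real.exp_le_one_iff.2
          nlinarith [sq_nonneg x]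
        exact mul_le_one₀ h1 (Real.exp_nonneg _) h2
    _ = _ := by simp

lemma gm_num (ε δ a L : ℝ) (hε : 0 < ε) (hε1 : ε < 1) (hδ : δ ∈ Set.Ioo (0 : ℝ) 1)
    (ha : 0 < a) (hL0 : 0 ≤ L) (hL : L ^ 2 = 2 * Real.log (1.25 / δ)) (haL : L ≤ ε / a) :
    gaussianReal 0 1 (Set.Ioi (ε / a - a / 2)) ≤ ENNReal.ofReal δ := by
  obtain ⟨hd0, hd1⟩ := hδ
  have hδe : δ = 1.25 * Real.exp (-L ^ 2 / 2) := by
    have : -L ^ 2 / 2 = - Real.log (1.25 / δ) := by linarith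
    rw [this, Real.exp_neg, Real.exp_log (by positivity)]
    field_simp
  obtain ⟨r, hr⟩ : ∃ r, r = ε / a := ⟨_, rfl⟩
  have hra : r * a = ε := by rw [hr]; field_simp
  rw [← hr] at haL ⊢
  have hL2 : L ^ 2 ≤ r ^ 2 := by gcongr
  rcases le_total 0 (r - a / 2) with ht | ht
  · refine (gm_tail _ ht).trans (ENNReal.ofReal_le_ofReal ?_)
    have h1 : Real.exp (-(r - a / 2) ^ 2 / 2) ≤ Real.exp (1 / 2 + -L ^ 2 / 2) := by
      apply Real.exp_le_exp.2
      nlinarith [sq_nonneg a]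
    rw [Real.exp_add] at h1
    have h2 : Real.exp (1 / 2) ≤ 2.5 := by
      have h3 : Real.exp (1 / 2) ≤ Real.exp 1 := Real.exp_le_exp.2 (by norm_num)
      have h4 : Real.exp (1 / 2) * Real.exp (1 / 2) = Real.exp 1 := by
        rw [← Real.exp_add]; norm_num
      nlinarith [Real.exp_one_lt_d9, Real.exp_pos (1 / 2)]
    rw [hδe]
    nlinarith [Real.exp_pos (-L ^ 2 / 2)]
  · refine (gm_mid _ ht).trans (ENNReal.ofReal_le_ofReal ?_)
    have h1 : L ^ 2 ≤ 1 / 2 := by nlinarith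
    have h2 : 0.9375 ≤ δ := by
      have := Real.add_one_le_exp (-L ^ 2 / 2)
      rw [hδe]; linarith
    have h3 : 0.36 ≤ L ^ 2 := by
      have h4 : 1.25 * Real.exp (-L ^ 2 / 2) < 1 := hδe ▸ hd1
      have := Real.add_one_le_exp (-L ^ 2 / 2)
      linarith
    have h5 : 0.6 ≤ L := by nlinarith
    have h6 : a * 0.6 ≤ 1 := by nlinarith
    linarith

theorem gm_core (ε δ σ : ℝ) (hσ : 0 < σ) (c c' τ : ℝ) (hτ : τ = 1 ∨ τ = -1)
    (hpos : 0 < τ * (c - c'))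
    (hT : gaussianReal 0 1 (Set.Ioi (ε / (τ * (c - c') / σ) - (τ * (c - c') / σ) / 2))
      ≤ ENNReal.ofReal δ) (A : Set ℝ) (hA : MeasurableSet A) :
    gaussianReal c (σ ^ 2).toNNReal A ≤
        ENNReal.ofReal (Real.exp ε) * gaussianReal c' (σ ^ 2).toNNReal A +
          ENNReal.ofReal δ := by
  have hv : (σ ^ 2).toNNReal ≠ 0 := by
    have : 0 < σ ^ 2 := by positivity
    simpa using hσ.ne'
  have hτ2 : τ * τ = 1 := by rcases hτ with h | h <;> simp [h]
  obtain ⟨a, ha⟩ : ∃ a, a = τ * (c - c') / σ := ⟨_, rfl⟩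
  have ha0 : 0 < a := by rw [ha]; positivity
  have hcc : c - c' = τ * (a * σ) := by
    rw [ha]; field_simp; rw [pow_two, hτ2]; ring
  rw [← ha] at hT
  let B : Set ℝ := {x | ε / a - a / 2 < τ / σ * (x - c)}
  have hB : MeasurableSet B := measurableSet_lt (by fun_prop) (by fun_prop)
  have hBm : gaussianReal c (σ ^ 2).toNNReal B ≤ ENNReal.ofReal δ := by
    have h1 : (gaussianReal c (σ ^ 2).toNNReal).map (fun x => τ / σ * (x - c))
        = gaussianReal 0 1 := by
      have e : (fun x => τ / σ * (x - c)) = (fun x => τ / σ * x) ∘ (fun x => x - c) := rfl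
      rw [e, ← Measure.map_map (by fun_prop) (by fun_prop), gaussianReal_map_sub_const,
        gaussianReal_map_const_mul]
      congr 1
      · simp
      · ext
        simp only [NNReal.coe_mul, NNReal.coe_mk, NNReal.coe_one]
        rw [Real.coe_toNNReal _ (by positivity)]
        field_simp
        nlinarith
    rw [← h1, Measure.map_apply (by fun_prop) measurableSet_Ioi] at hT
    exact hT
  have hAB : gaussianReal c (σ ^ 2).toNNReal (A \ B) ≤
      ENNReal.ofReal (Real.exp ε) * gaussianReal c' (σ ^ 2).toNNReal (A \ B) := by
    rw [gaussianReal_apply _ hv, gaussianReal_apply _ hv,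
      ← lintegral_const_mul _ (measurable_gaussianPDF _ _)]
    apply setLIntegral_mono' (hA.diff hB)
    intro x hx
    have hx : τ / σ * (x - c) ≤ ε / a - a / 2 := not_lt.1 hx.2
    rw [gaussianPDF, gaussianPDF, ← ENNReal.ofReal_mul (Real.exp_nonneg _)]
    apply ENNReal.ofReal_le_ofReal
    simp only [gaussianPDFReal]
    rw [Real.coe_toNNReal _ (by positivity), mul_left_comm, ← Real.exp_add]
    apply mul_le_mul_of_nonneg_left _ (by positivity)
    apply Real.exp_le_exp.2
    obtain ⟨y, hy⟩ : ∃ y, y = τ / σ * (x - c) := ⟨_, rfl⟩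
    have hxc : x - c = τ * (y * σ) := by
      rw [hy]; field_simp; rw [pow_two, hτ2]; ring
    have hxc' : x - c' = τ * ((y + a) * σ) := by linear_combination hxc + hcc
    rw [hxc, hxc']
    have e1 : ∀ z : ℝ, -(τ * (z * σ)) ^ 2 / (2 * σ ^ 2) = -z ^ 2 / 2 := by
      intro z
      rw [mul_pow, pow_two τ, hτ2]; field_simp
    rw [e1, e1]
    rw [← hy] at hx
    have h3 : y * a ≤ (ε / a - a / 2) * a := by gcongr
    have h4 : (ε / a - a / 2) * a = ε - a ^ 2 / 2 := by field_simp
    nlinarith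
  calc gaussianReal c (σ ^ 2).toNNReal A
      ≤ gaussianReal c (σ ^ 2).toNNReal ((A \ B) ∪ B) := by
        apply measure_mono; intro x hx; by_cases h : x ∈ B <;> simp [h, hx]
    _ ≤ gaussianReal c (σ ^ 2).toNNReal (A \ B) + gaussianReal c (σ ^ 2).toNNReal B :=
        measure_union_le _ _
    _ ≤ _ := by
        refine add_le_add (hAB.trans ?_) hBm
        gcongr
        exact Set.sdiff_subset

/-- The Gaussian mechanism guarantee underlying the privacy analysis of
Gau-LRQ: if `σ ≥ s·√(2 ln(1.25/δ))/ε` then for any two means at distance at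
most `s`, the Gaussian measures `N(c, σ²)` and `N(c', σ²)` satisfy the
`(ε, δ)`-differential-privacy inequality on every Borel set. -/
theorem gaussian_mechanism_dp
    (ε δ s σ : ℝ)
    (hε : ε ∈ Set.Ioo (0 : ℝ) 1) (hδ : δ ∈ Set.Ioo (0 : ℝ) 1)
    (hs : 0 < s) (hσpos : 0 < σ)
    (hσ : σ ≥ s * Real.sqrt (2 * Real.log (1.25 / δ)) / ε) :
    ∀ c c' : ℝ, |c - c'| ≤ s → ∀ A : Set ℝ, MeasurableSet A →
      gaussianReal c (σ ^ 2).toNNReal A ≤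
        ENNReal.ofReal (Real.exp ε) * gaussianReal c' (σ ^ 2).toNNReal A +
          ENNReal.ofReal δ := by
  intro c c' hc A hA
  obtain ⟨hε0, hε1⟩ := hε
  have hlog : 0 ≤ Real.log (1.25 / δ) := by
    apply Real.log_nonneg
    rw [le_div_iff₀ hδ.1]; linarith [hδ.2]
  have key : ∀ τ : ℝ, (τ = 1 ∨ τ = -1) → 0 < τ * (c - c') → τ * (c - c') ≤ s →
      gaussianReal c (σ ^ 2).toNNReal A ≤
        ENNReal.ofReal (Real.exp ε) * gaussianReal c' (σ ^ 2).toNNReal A +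
          ENNReal.ofReal δ := by
    intro τ hτ hpos hle
    refine gm_core ε δ σ hσpos c c' τ hτ hpos ?_ A hA
    refine gm_num ε δ _ (Real.sqrt (2 * Real.log (1.25 / δ))) hε0 hε1 hδ (by positivity)
      (Real.sqrt_nonneg _) (Real.sq_sqrt (by positivity)) ?_
    rw [le_div_iff₀ (by positivity), mul_div_assoc', div_le_iff₀ hσpos]
    rw [ge_iff_le, div_le_iff₀ hε0] at hσ
    nlinarith [mul_le_mul_of_nonneg_left hle (Real.sqrt_nonneg (2 * Real.log (1.25 / δ)))]
  rcases lt_trichotomy (c - c') 0 with h | h | h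
  · exact key (-1) (Or.inr rfl) (by linarith) (by linarith [neg_le_abs (c - c')])
  · have : c = c' := by linarith
    subst this
    refine le_trans ?_ (le_add_of_nonneg_right zero_le)
    refine le_mul_of_one_le_left zero_le ?_
    rw [ENNReal.one_le_ofReal]
    exact Real.one_le_exp hε0.le
  · exact key 1 (Or.inl rfl) (by linarith) (by linarith [le_abs_self (c - c')])
end
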